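/- Let G be a simple graph on a finite vertex set V in which every vertex has degree at most 3. Then there exist a natural number N and ε₀ ∈ (0, 1) such that for all natural numbers n ≥ N and all ε ∈ (ε₀, 1): a subset V* ⊆ V maximizes the sum rate R^s(·, n, ε) over all subsets of V if and only if V* is a maximum independent set of G. -/

import Mathlib

open Filter Topology

/-- The number `N_Ṽ(v)` of vertices of `Ṽ` adjacent to `v`. -/
def numAdj {V : Type*} [DecidableEq V] (G : SimpleGraph V) [DecidableRel G.Adj]
    (T : Finset V) (v : V) : ℕ :=
  (T.filter (fun u => G.Adj v u)).card

/-- The sum rate `R^s(Ṽ, n, ε) = ∑_{v ∈ Ṽ} log₂(1 + n/(1 + N_Ṽ(v)·ε·n))`. -/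
noncomputable def sumRate {V : Type*} [DecidableEq V] (G : SimpleGraph V) [DecidableRel G.Adj]
    (T : Finset V) (n : ℕ) (ε : ℝ) : ℝ :=
  ∑ v ∈ T, Real.logb 2 (1 + (n : ℝ) / (1 + (numAdj G T v : ℝ) * ε * n))

/-- `Ṽ` is an independent set of `G`: no two of its vertices are adjacent. -/
def IsIndepSet {V : Type*} (G : SimpleGraph V) (T : Finset V) : Prop :=
  ∀ u ∈ T, ∀ w ∈ T, ¬ G.Adj u w

/-- `Ṽ` is a maximum independent set of `G`: an independent set of maximum cardinality. -/
def IsMaxIndepSet {V : Type*} (G : SimpleGraph V) (T : Finset V) : Prop :=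
  IsIndepSet G T ∧ ∀ W : Finset V, IsIndepSet G W → W.card ≤ T.card

theorem exists_isMaxIndepSet {V : Type*} [Fintype V] (G : SimpleGraph V) :
    ∃ M : Finset V, IsMaxIndepSet G M := by
  classical
  obtain ⟨M, hM, hmax⟩ := Finset.exists_max_image
    (Finset.univ.filter fun T : Finset V => IsIndepSet G T) Finset.card
    ⟨∅, Finset.mem_filter.2 ⟨Finset.mem_univ _, by simp [IsIndepSet]⟩⟩
  exact ⟨M, (Finset.mem_filter.1 hM).2, fun W hW => hmax W (by simpa using hW)⟩

section SumRate

variable {V : Type*} [DecidableEq V] (G : SimpleGraph V) [DecidableRel G.Adj]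

theorem numAdj_eq_zero_iff {T : Finset V} {v : V} :
    numAdj G T v = 0 ↔ ∀ u ∈ T, ¬ G.Adj v u := by
  simp [numAdj, Finset.filter_eq_empty_iff]

theorem sumRate_eq_of_isIndepSet {T : Finset V} (hT : IsIndepSet G T) (n : ℕ) (ε : ℝ) :
    sumRate G T n ε = T.card * Real.logb 2 (1 + n) := by
  rw [sumRate, ← nsmul_eq_mul, ← Finset.sum_const]
  refine Finset.sum_congr rfl fun v hv => ?_
  simp [(numAdj_eq_zero_iff G).2 (hT v hv)]

/-- A vertex with at least one neighbour in the chosen set has rate at most 2. -/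
theorem logb_rate_le_two {k n : ℕ} (hk : k ≠ 0) {ε : ℝ} (hε : 1 / 2 ≤ ε) :
    Real.logb 2 (1 + (n : ℝ) / (1 + (k : ℝ) * ε * n)) ≤ 2 := by
  have hk : (1 : ℝ) ≤ k := by exact_mod_cast Nat.one_le_iff_ne_zero.2 hk
  have hn : (0 : ℝ) ≤ n := n.cast_nonneg
  have hkε : 1 / 2 ≤ (k : ℝ) * ε := by nlinarith
  have hden : 0 < 1 + (k : ℝ) * ε * n := by nlinarith
  have hfrac : (n : ℝ) / (1 + (k : ℝ) * ε * n) ≤ 2 := by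
    rw [div_le_iff₀ hden]
    nlinarith
  rw [Real.logb_le_iff_le_rpow one_lt_two (by positivity)]
  norm_num
  linarith

/-- The isolated vertices of a set that is not a maximum independent set are fewer than the
independence number. -/
theorem card_isolated_lt {T M : Finset V} (hM : IsMaxIndepSet G M) (hT : ¬ IsMaxIndepSet G T) :
    (T.filter fun v => numAdj G T v = 0).card < M.card := by
  set I := T.filter fun v => numAdj G T v = 0 with hI
  have hadj : ∀ v ∈ I, ∀ u ∈ T, ¬ G.Adj v u := fun v hv =>
    (numAdj_eq_zero_iff G).1 (Finset.mem_filter.1 hv).2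
  have hIT : I ⊆ T := Finset.filter_subset _ _
  have hIind : IsIndepSet G I := fun u hu w hw => hadj u hu w (hIT hw)
  by_cases h : T ⊆ I
  · rw [Finset.Subset.antisymm hIT h] at hIind ⊢
    by_contra! hcard
    exact hT ⟨hIind, fun W hW => (hM.2 W hW).trans hcard⟩
  · obtain ⟨v, hvT, hvI⟩ := Finset.not_subset.1 h
    have hins : IsIndepSet G (insert v I) := by
      intro u hu w hw huw
      rcases Finset.mem_insert.1 hu with rfl | hu
      · rcases Finset.mem_insert.1 hw with rfl | hw
        · exact G.irrefl huw
        · exact hadj w hw u hvT huw.symm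
      · exact hadj u hu w (Finset.insert_subset hvT hIT hw) huw
    have := hM.2 _ hins
    rw [Finset.card_insert_of_notMem hvI] at this
    exact this

theorem sumRate_lt_of_isMaxIndepSet [Fintype V] {T M : Finset V} (hM : IsMaxIndepSet G M)
    (hT : ¬ IsMaxIndepSet G T) {n : ℕ} {ε : ℝ} (hε : 1 / 2 ≤ ε)
    (hn : 2 * (Fintype.card V : ℝ) < Real.logb 2 (1 + n)) :
    sumRate G T n ε < sumRate G M n ε := by
  have hcard : ((T.filter fun v => numAdj G T v = 0).card : ℝ) + 1 ≤ M.card := by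
    exact_mod_cast card_isolated_lt G hM hT
  have hiso : ∑ v ∈ T.filter (fun v => numAdj G T v = 0),
        Real.logb 2 (1 + (n : ℝ) / (1 + (numAdj G T v : ℝ) * ε * n)) =
      (T.filter fun v => numAdj G T v = 0).card * Real.logb 2 (1 + n) := by
    rw [← nsmul_eq_mul, ← Finset.sum_const]
    refine Finset.sum_congr rfl fun v hv => ?_
    simp [(Finset.mem_filter.1 hv).2]
  have hrest : ∑ v ∈ T.filter (fun v => ¬ numAdj G T v = 0),
        Real.logb 2 (1 + (n : ℝ) / (1 + (numAdj G T v : ℝ) * ε * n)) ≤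
      (T.filter fun v => ¬ numAdj G T v = 0).card * 2 := by
    rw [← nsmul_eq_mul]
    exact Finset.sum_le_card_nsmul _ _ _ fun v hv =>
      logb_rate_le_two (Finset.mem_filter.1 hv).2 hε
  have hV : ((T.filter fun v => ¬ numAdj G T v = 0).card : ℝ) ≤ Fintype.card V := by
    exact_mod_cast Finset.card_le_univ _
  rw [sumRate_eq_of_isIndepSet G hM.1, sumRate,
    ← Finset.sum_filter_add_sum_filter_not T (fun v => numAdj G T v = 0), hiso]
  have hL : 0 ≤ Real.logb 2 (1 + (n : ℝ)) := hn.le.trans' (by positivity)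
  nlinarith [mul_le_mul_of_nonneg_right hcard hL]

end SumRate

/-- If every vertex of `G` has degree at most 3, then for all sufficiently large `n` and all
`ε` sufficiently close to (and below) 1, a subset maximizes the sum rate over all subsets of
`V` if and only if it is a maximum independent set of `G`. -/
theorem maximizes_sumRate_iff_maxIndepSet {V : Type*} [Fintype V] [DecidableEq V]
    (G : SimpleGraph V) [DecidableRel G.Adj] (hdeg : ∀ v : V, G.degree v ≤ 3) :
    ∃ N : ℕ, ∃ ε₀ ∈ Set.Ioo (0 : ℝ) 1,
      ∀ n : ℕ, N ≤ n → ∀ ε ∈ Set.Ioo ε₀ (1 : ℝ),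
        ∀ Vstar : Finset V,
          (∀ T : Finset V, sumRate G T n ε ≤ sumRate G Vstar n ε) ↔
            IsMaxIndepSet G Vstar := by
  obtain ⟨M, hM⟩ := exists_isMaxIndepSet G
  have hlim : Tendsto (fun n : ℕ => Real.logb 2 (1 + (n : ℝ))) atTop atTop :=
    (Real.tendsto_logb_atTop one_lt_two).comp
      (tendsto_atTop_add_const_left _ _ tendsto_natCast_atTop_atTop)
  obtain ⟨N, hN⟩ := eventually_atTop.1 (hlim.eventually_gt_atTop (2 * (Fintype.card V : ℝ)))
  refine ⟨N, 1 / 2, by norm_num, fun n hn ε hε S => ⟨fun hS => ?_, fun hS T => ?_⟩⟩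
  · by_contra h
    exact (sumRate_lt_of_isMaxIndepSet G hM h hε.1.le (hN n hn)).not_ge (hS M)
  · by_cases hT : IsMaxIndepSet G T
    · rw [sumRate_eq_of_isIndepSet G hT.1, sumRate_eq_of_isIndepSet G hS.1,
        le_antisymm (hS.2 T hT.1) (hT.2 S hS.1)]
    · exact (sumRate_lt_of_isMaxIndepSet G hS hT hε.1.le (hN n hn)).le
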